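/- (Unique solvability of the dual eigenvalue problem for the renewal equation) Let B ∈ L^∞(ℝ₊; ℝ₊) with ∫₀^∞ B(x) dx > 1, let λ₀ > 0 be the unique number with ∫₀^∞ B(x) e^{−λ₀ x} dx = 1, and set N(x) := λ₀ e^{−λ₀ x}. Then there exists a unique bounded, locally Lipschitz function φ : ℝ₊ → [0,∞) satisfying −φ'(x) + λ₀ φ(x) = φ(0) B(x) for almost every x ≥ 0 and ∫₀^∞ N(x) φ(x) dx = 1; explicitly, φ(x) = φ(0) e^{λ₀ x} ∫_x^∞ B(y) e^{−λ₀ y} dy with φ(0) = (λ₀ ∫₀^∞ y B(y) e^{−λ₀ y} dy)^{−1}. -/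

import Mathlib

open MeasureTheory

open Set Filter

section TailIntegral

/-- Layer-cake formula for the first moment of a density on the half-line. -/
theorem integral_tail_eq_integral_id_mul {f : ℝ → ℝ} (hf : Measurable f) (hf0 : ∀ x, 0 ≤ f x)
    (hint : IntegrableOn (fun y => y * f y) (Ici 0)) :
    ∫ t in Ioi (0:ℝ), ∫ y in Ici t, f y = ∫ y in Ici (0:ℝ), y * f y := by
  set μ : Measure ℝ := (volume.restrict (Ici (0:ℝ))).withDensity fun y => ENNReal.ofReal (f y)
    with hμ
  have hm : Measurable fun y => ENNReal.ofReal (f y) := hf.ennreal_ofReal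
  have hlt : ∀ᵐ y ∂(volume.restrict (Ici (0:ℝ))), ENNReal.ofReal (f y) < ⊤ :=
    Eventually.of_forall fun _ => ENNReal.ofReal_lt_top
  have hid : Integrable (fun y : ℝ => y) μ := by
    rw [hμ, integrable_withDensity_iff hm hlt]
    simp only [ENNReal.toReal_ofReal (hf0 _)]
    exact hint
  have hnn : 0 ≤ᵐ[μ] fun y : ℝ => y :=
    (withDensity_absolutelyContinuous _ _).ae_le
      ((ae_restrict_mem measurableSet_Ici).mono fun _ hy => hy)
  have key := hid.integral_eq_integral_meas_le hnn
  rw [hμ, integral_withDensity_eq_integral_toReal_smul hm hlt] at key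
  simp only [ENNReal.toReal_ofReal (hf0 _), smul_eq_mul] at key
  rw [← hμ] at key
  rw [show (∫ y in Ici (0:ℝ), y * f y) = ∫ y in Ici (0:ℝ), f y * y by simp only [mul_comm], key]
  refine setIntegral_congr_fun measurableSet_Ioi fun t ht => ?_
  have hset : {a : ℝ | t ≤ a} = Ici t := rfl
  simp only [hset]
  rw [measureReal_def, hμ, withDensity_apply _ measurableSet_Ici,
    Measure.restrict_restrict measurableSet_Ici,
    inter_eq_left.mpr (Ici_subset_Ici.mpr (le_of_lt ht)),
    integral_eq_lintegral_of_nonneg_ae (Eventually.of_forall hf0) hf.aestronglyMeasurable]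

variable {g : ℝ → ℝ} {M lam : ℝ}

theorem integrableOn_Ici_of_le_exp (hg : Measurable g) (hg0 : ∀ x, 0 ≤ g x) (hlam : 0 < lam)
    (hgM : ∀ x, g x ≤ M * Real.exp (-(lam * x))) (a : ℝ) : IntegrableOn g (Ici a) := by
  rw [integrableOn_Ici_iff_integrableOn_Ioi]
  have h := (integrableOn_exp_mul_Ioi (neg_lt_zero.mpr hlam) a).const_mul M
  refine h.mono' hg.aestronglyMeasurable (Eventually.of_forall fun x => ?_)
  rw [Real.norm_of_nonneg (hg0 x), neg_mul]
  exact hgM x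

theorem integrableOn_Ici_id_mul_of_le_exp (hg : Measurable g) (hg0 : ∀ x, 0 ≤ g x) (hlam : 0 < lam)
    (hgM : ∀ x, g x ≤ M * Real.exp (-(lam * x))) : IntegrableOn (fun y => y * g y) (Ici 0) := by
  rw [integrableOn_Ici_iff_integrableOn_Ioi]
  have h := (integrableOn_rpow_mul_exp_neg_mul_rpow (p := 1) (s := 1) (by norm_num) one_pos
    hlam).const_mul M
  refine h.mono' (measurable_id.mul hg).aestronglyMeasurable
    ((ae_restrict_mem measurableSet_Ioi).mono fun x hx => ?_)
  have hx0 : (0:ℝ) < x := hx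
  rw [Real.norm_of_nonneg (mul_nonneg hx0.le (hg0 x)), Real.rpow_one, neg_mul]
  calc x * g x ≤ x * (M * Real.exp (-(lam * x))) := by gcongr; exact hgM x
    _ = _ := by ring

theorem integral_Ici_le_of_le_exp (hg : Measurable g) (hg0 : ∀ x, 0 ≤ g x) (hlam : 0 < lam)
    (hgM : ∀ x, g x ≤ M * Real.exp (-(lam * x))) (x : ℝ) :
    ∫ y in Ici x, g y ≤ M / lam * Real.exp (-(lam * x)) := by
  have h := (integrableOn_exp_mul_Ioi (neg_lt_zero.mpr hlam) x).const_mul M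
  have hi := integrableOn_Ici_of_le_exp hg hg0 hlam hgM x
  rw [integral_Ici_eq_integral_Ioi]
  calc ∫ y in Ioi x, g y ≤ ∫ y in Ioi x, M * Real.exp (-lam * y) :=
        integral_mono (hi.mono_set Ioi_subset_Ici_self) h fun y => by simpa using hgM y
    _ = M / lam * Real.exp (-(lam * x)) := by
        rw [integral_const_mul, integral_exp_mul_Ioi (neg_lt_zero.mpr hlam), neg_mul]
        field_simp

theorem ae_hasDerivAt_integral_Ici (hint : ∀ a, IntegrableOn g (Ici a)) :
    ∀ᵐ x, HasDerivAt (fun x => ∫ y in Ici x, g y) (-g x) x := by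
  have hloc : LocallyIntegrable g volume := fun x =>
    ⟨Ici (x - 1), Ici_mem_nhds (by linarith), hint _⟩
  filter_upwards [LocallyIntegrable.ae_hasDerivAt_integral hloc] with x hx
  have heq : (fun x => ∫ y in Ici x, g y) = fun x => (∫ y in Ici 0, g y) - ∫ y in (0:ℝ)..x, g y := by
    funext x
    rw [← intervalIntegral.integral_Ici_sub_Ici' (hint 0) (hint x)]
    ring
  rw [heq]
  exact (hx 0).const_sub _

theorem lipschitzOnWith_integral_Ici {s : Set ℝ} (hs : s.OrdConnected)
    (hint : ∀ a, IntegrableOn g (Ici a)) (hgM : ∀ x ∈ s, |g x| ≤ M) :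
    LipschitzOnWith M.toNNReal (fun x => ∫ y in Ici x, g y) s := by
  refine LipschitzOnWith.of_dist_le_mul fun x hx y hy => ?_
  have hM : 0 ≤ M := (abs_nonneg _).trans (hgM x hx)
  rw [Real.dist_eq, intervalIntegral.integral_Ici_sub_Ici' (hint x) (hint y),
    Real.coe_toNNReal _ hM, dist_comm, Real.dist_eq]
  exact intervalIntegral.norm_integral_le_of_norm_le_const (f := g) fun z hz =>
    hgM z (hs.uIcc_subset hx hy (uIoc_subset_uIcc hz))

/-- An absolutely continuous function whose derivative is a.e. a multiple of `g`
is recovered from the tail integral of `g`. -/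
theorem AbsolutelyContinuousOnInterval.eq_sub_mul_integral_tail {u : ℝ → ℝ} {x k : ℝ}
    (hx : 0 ≤ x) (hu : AbsolutelyContinuousOnInterval u 0 x)
    (hint : ∀ a, IntegrableOn g (Ici a))
    (hT : AbsolutelyContinuousOnInterval (fun x => ∫ y in Ici x, g y) 0 x)
    (hder : ∀ᵐ y ∂(volume.restrict (Ici (0:ℝ))), HasDerivAt u (-(k * g y)) y) :
    u x - k * ∫ y in Ici x, g y = u 0 - k * ∫ y in Ici 0, g y := by
  have hac := hu.sub (hT.const_mul k)
  obtain ⟨C, hC⟩ := hac.const_of_ae_hasDerivAt_zero (by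
    filter_upwards [(ae_restrict_iff' measurableSet_Ici).mp hder,
      ae_hasDerivAt_integral_Ici hint] with y hy1 hy2 hy
    rw [uIcc_of_le hx] at hy
    convert! (hy1 hy.1).sub (hy2.const_mul k) using 1
    ring)
  exact (hC x right_mem_uIcc).trans (hC 0 left_mem_uIcc).symm

end TailIntegral

/-- The product of two bounded Lipschitz functions is Lipschitz. -/
theorem LipschitzOnWith.exists_mul_of_abs_le {f h : ℝ → ℝ} {s : Set ℝ} {K L : NNReal} {A C : ℝ}
    (hf : LipschitzOnWith K f s) (hh : LipschitzOnWith L h s) (hA : ∀ x ∈ s, |f x| ≤ A)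
    (hC : ∀ x ∈ s, |h x| ≤ C) : ∃ J : NNReal, LipschitzOnWith J (fun x => f x * h x) s := by
  refine ⟨(A * L + C * K).toNNReal, LipschitzOnWith.of_dist_le_mul fun x hx y hy => ?_⟩
  have h1 := hf.dist_le_mul x hx y hy
  have h2 := hh.dist_le_mul x hx y hy
  rw [Real.dist_eq] at h1 h2 ⊢
  have hA0 : 0 ≤ A := (abs_nonneg _).trans (hA x hx)
  calc |f x * h x - f y * h y| = |f x * (h x - h y) + (f x - f y) * h y| := by ring_nf
    _ ≤ |f x| * |h x - h y| + |f x - f y| * |h y| := by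
        rw [← abs_mul, ← abs_mul]; exact abs_add_le _ _
    _ ≤ A * (L * dist x y) + (K * dist x y) * C := by
        gcongr
        · exact hA x hx
        · exact hC y hy
    _ = (A * L + C * K) * dist x y := by ring
    _ ≤ (A * L + C * K).toNNReal * dist x y := by gcongr; exact Real.le_coe_toNNReal _

/-- Unique solvability of the dual eigenvalue problem for the renewal
equation.  With `N(x) = λ₀ e^{-λ₀ x}` and `∫₀^∞ B e^{-λ₀ x} = 1`, the function
`φ(x) = φ(0) e^{λ₀ x} ∫_x^∞ B(y) e^{-λ₀ y} dy`, `φ(0) = (λ₀ ∫₀^∞ y B(y) e^{-λ₀ y} dy)⁻¹`,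
is the unique bounded, locally Lipschitz, non-negative function satisfying
`-φ' + λ₀ φ = φ(0) B` a.e. on `ℝ₊` and `∫₀^∞ N φ = 1`. -/
theorem stmt_14 (B : ℝ → ℝ) (hBmeas : Measurable B) (hB0 : ∀ x, 0 ≤ B x)
    (hBbdd : ∃ M : ℝ, ∀ x, B x ≤ M)
    (hBgt : 1 < ∫⁻ x in Set.Ici (0:ℝ), ENNReal.ofReal (B x))
    (lam : ℝ) (hlam : 0 < lam)
    (hlameq : (∫ x in Set.Ici (0:ℝ), B x * Real.exp (-(lam * x))) = 1)
    (c : ℝ) (hc : c = (lam * ∫ y in Set.Ici (0:ℝ), y * B y * Real.exp (-(lam * y)))⁻¹)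
    (φ : ℝ → ℝ)
    (hφ : ∀ x, φ x = c * Real.exp (lam * x) * ∫ y in Set.Ici x, B y * Real.exp (-(lam * y))) :
    (φ 0 = c ∧
      (∃ M : ℝ, ∀ x : ℝ, 0 ≤ x → φ x ≤ M) ∧
      (∀ x : ℝ, 0 ≤ x → 0 ≤ φ x) ∧
      (∀ R : ℝ, 0 < R → ∃ K : NNReal, LipschitzOnWith K φ (Set.Icc 0 R)) ∧
      (∀ᵐ x ∂(volume.restrict (Set.Ici (0:ℝ))),
        HasDerivAt φ (lam * φ x - φ 0 * B x) x) ∧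
      (∫ x in Set.Ici (0:ℝ), (lam * Real.exp (-(lam * x))) * φ x) = 1) ∧
    ∀ ψ : ℝ → ℝ,
      (∃ M : ℝ, ∀ x : ℝ, 0 ≤ x → ψ x ≤ M) →
      (∀ x : ℝ, 0 ≤ x → 0 ≤ ψ x) →
      (∀ R : ℝ, 0 < R → ∃ K : NNReal, LipschitzOnWith K ψ (Set.Icc 0 R)) →
      (∀ᵐ x ∂(volume.restrict (Set.Ici (0:ℝ))),
        HasDerivAt ψ (lam * ψ x - ψ 0 * B x) x) →
      (∫ x in Set.Ici (0:ℝ), (lam * Real.exp (-(lam * x))) * ψ x) = 1 →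
      ∀ x : ℝ, 0 ≤ x → ψ x = φ x := by
  obtain ⟨M, hM⟩ := hBbdd
  have hM0 : 0 ≤ M := (hB0 0).trans (hM 0)
  set g : ℝ → ℝ := fun y => B y * Real.exp (-(lam * y)) with hgdef
  have hgm : Measurable g := by fun_prop
  have hg0 : ∀ x, 0 ≤ g x := fun x => mul_nonneg (hB0 x) (Real.exp_pos _).le
  have hgM : ∀ x, g x ≤ M * Real.exp (-(lam * x)) := fun x =>
    mul_le_mul_of_nonneg_right (hM x) (Real.exp_pos _).le
  have hint := integrableOn_Ici_of_le_exp hgm hg0 hlam hgM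
  have hint1 := integrableOn_Ici_id_mul_of_le_exp hgm hg0 hlam hgM
  have hTder := ae_hasDerivAt_integral_Ici hint
  have hTle := integral_Ici_le_of_le_exp hgm hg0 hlam hgM
  have htail := integral_tail_eq_integral_id_mul hgm hg0 hint1
  set T : ℝ → ℝ := fun x => ∫ y in Ici x, g y with hTdef
  have hT1 : T 0 = 1 := hlameq
  have hT0 : ∀ x, 0 ≤ T x := fun x => integral_nonneg hg0
  have hTLip : LipschitzOnWith M.toNNReal T (Ici 0) :=
    lipschitzOnWith_integral_Ici ordConnected_Ici hint fun x hx => by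
      rw [abs_of_nonneg (hg0 x)]
      refine (hgM x).trans (mul_le_of_le_one_right hM0 (Real.exp_le_one_iff.mpr ?_))
      have : 0 ≤ lam * x := mul_nonneg hlam.le hx
      linarith
  set m : ℝ := ∫ y in Ici (0:ℝ), y * g y with hm
  have hcm : c = (lam * m)⁻¹ := by
    rw [hc, hm]; simp only [hgdef, mul_assoc]
  have hmpos : 0 < m := by
    have hnn : 0 ≤ᵐ[volume.restrict (Ici (0:ℝ))] fun y => y * g y :=
      (ae_restrict_mem measurableSet_Ici).mono fun y hy => mul_nonneg hy (hg0 y)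
    refine lt_of_le_of_ne (integral_nonneg_of_ae hnn) fun h0 => ?_
    have hz := (integral_eq_zero_iff_of_nonneg_ae hnn hint1).mp h0.symm
    have hgz : ∫ y in Ioi (0:ℝ), g y = 0 := by
      refine integral_eq_zero_of_ae ?_
      filter_upwards [ae_mono (Measure.restrict_mono Ioi_subset_Ici_self le_rfl) hz,
        ae_restrict_mem measurableSet_Ioi] with y hy hy0
      exact (mul_eq_zero.mp hy).resolve_left (ne_of_gt hy0)
    rw [← integral_Ici_eq_integral_Ioi] at hgz
    exact one_ne_zero (hT1.symm.trans hgz)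
  have hcpos : 0 < c := by rw [hcm]; positivity
  have hmass : ∀ k : ℝ, ∀ ψ : ℝ → ℝ, (∀ x, 0 ≤ x → ψ x = k * Real.exp (lam * x) * T x) →
      (∫ x in Ici (0:ℝ), (lam * Real.exp (-(lam * x))) * ψ x) = k * (lam * m) := by
    intro k ψ hψ
    rw [integral_Ici_eq_integral_Ioi, ← htail, ← integral_const_mul, ← integral_const_mul]
    refine setIntegral_congr_fun measurableSet_Ioi fun x hx => ?_
    simp only [hψ x (le_of_lt hx), Real.exp_neg]
    field_simp
    rfl
  have hφ0 : φ 0 = c := by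
    rw [hφ 0]
    change c * Real.exp (lam * 0) * T 0 = c
    simp [hT1]
  refine ⟨⟨hφ0, ⟨c * (M / lam), fun x _ => ?_⟩, fun x _ => ?_, fun R hR => ?_, ?_, ?_⟩, ?_⟩
  · rw [hφ x]
    calc c * Real.exp (lam * x) * T x
        ≤ c * Real.exp (lam * x) * (M / lam * Real.exp (-(lam * x))) := by
          gcongr; exact hTle x
      _ = c * (M / lam) := by rw [Real.exp_neg]; field_simp
  · rw [hφ x]
    exact mul_nonneg (mul_nonneg hcpos.le (Real.exp_pos _).le) (hT0 x)
  · have hE : ContDiffOn ℝ 1 (fun x => c * Real.exp (lam * x)) (Icc 0 R) := by fun_prop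
    obtain ⟨K, hK⟩ := hE.exists_lipschitzOnWith (by decide) (convex_Icc _ _) isCompact_Icc
    have hTR := hTLip.mono (fun x (hx : x ∈ Icc 0 R) => hx.1)
    obtain ⟨A, hA⟩ := isCompact_Icc.exists_bound_of_continuousOn hK.continuousOn
    obtain ⟨C, hC⟩ := isCompact_Icc.exists_bound_of_continuousOn hTR.continuousOn
    rw [funext hφ]
    exact hK.exists_mul_of_abs_le hTR hA hC
  · refine ae_restrict_of_ae ?_
    filter_upwards [hTder] with x hx
    rw [hφ0, funext hφ]
    convert! (((hasDerivAt_id x).const_mul lam).exp.const_mul c).mul hx using 1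
    change lam * (c * Real.exp (lam * x) * T x) - c * B x = _
    simp only [hgdef, Real.exp_neg, id]
    field_simp
    ring
  · rw [hmass c φ fun x _ => hφ x, hcm]
    exact inv_mul_cancel₀ (by positivity)
  · intro ψ _ _ hLip hder hone
    have hrep : ∀ x, 0 ≤ x → ψ x = ψ 0 * Real.exp (lam * x) * T x := by
      intro x hx
      obtain ⟨K, hK⟩ := hLip (x + 1) (by linarith)
      have hsub : uIcc 0 x ⊆ Icc 0 (x + 1) := by
        rw [uIcc_of_le hx]; exact Icc_subset_Icc_right (by linarith)
      have hE : ContDiffOn ℝ 1 (fun x => Real.exp (-(lam * x))) (uIcc 0 x) := by fun_prop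
      have hu := hE.absolutelyContinuousOnInterval.mul (hK.mono hsub).absolutelyContinuousOnInterval
      have hT := (hTLip.mono (hsub.trans Icc_subset_Ici_self)).absolutelyContinuousOnInterval
      have := hu.eq_sub_mul_integral_tail (k := ψ 0) hx hint hT (by
        filter_upwards [hder] with y hy
        convert! (((hasDerivAt_id y).const_mul lam).neg.exp).mul hy using 1
        simp only [hgdef, id, Pi.neg_apply]
        ring)
      change Real.exp (-(lam * x)) * ψ x - ψ 0 * T x = Real.exp (-(lam * 0)) * ψ 0 - ψ 0 * T 0
        at this
      rw [hT1] at this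
      simp only [mul_zero, neg_zero, Real.exp_zero, one_mul, mul_one, sub_self, Real.exp_neg] at this
      field_simp at this
      linarith
    have hψ0 : ψ 0 = c := by
      rw [hmass (ψ 0) ψ hrep] at hone
      rw [hcm]
      exact eq_inv_of_mul_eq_one_left hone
    intro x hx
    rw [hrep x hx, hφ x, hψ0]
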